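/- Fix δ ∈ (0, 1], σ_w > 0, and γ ∈ (0, 1). Then there is at most one pair (σ, τ) with σ > 0 and τ > 0 satisfying both fixed-point equations σ² = σ_w² + (1/δ)·E[(η(X + σZ; τ) − X)²] and γ = (1/δ)·P(|X + σZ| ≥ τ); that is, if (σ₁, τ₁) and (σ₂, τ₂) both satisfy these two equations with σᵢ, τᵢ > 0, then σ₁ = σ₂ and τ₁ = τ₂. -/

import Mathlib

open MeasureTheory

/-- Standard Gaussian density `φ(z) = e^{-z²/2}/√(2π)`. -/
noncomputable def gaussPDF (z : ℝ) : ℝ := Real.exp (-z ^ 2 / 2) / Real.sqrt (2 * Real.pi)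

/-- Soft-thresholding function `η(x; τ) = sign(x)·max(|x| − τ, 0)`. -/
noncomputable def softThr (x τ : ℝ) : ℝ := Real.sign x * max (|x| - τ) 0

/-- Soft-thresholding risk `r(τ; G) = E_{μ∼G, Z∼N(0,1)}[(η(μ + Z; τ) − μ)²]`. -/
noncomputable def stRisk (G : Measure ℝ) (τ : ℝ) : ℝ :=
  ∫ m, (∫ z, (softThr (m + z) τ - m) ^ 2 * gaussPDF z) ∂G

open ProbabilityTheory

theorem gp_eq (z : ℝ) : gaussPDF z = gaussianPDFReal 0 1 z := by
  simp [gaussPDF, gaussianPDFReal]; ring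

theorem gp_pos (z : ℝ) : 0 < gaussPDF z := by
  unfold gaussPDF; positivity

theorem gp_cont : Continuous gaussPDF := by
  unfold gaussPDF; fun_prop

theorem gp_int : Integrable gaussPDF := by
  have h : gaussPDF = gaussianPDFReal 0 1 := funext gp_eq
  rw [h]; exact integrable_gaussianPDFReal 0 1

theorem gp_one : ∫ z, gaussPDF z = 1 := by
  simp_rw [gp_eq]; exact integral_gaussianPDFReal_eq_one 0 one_ne_zero

theorem gp_int_pow (n : ℕ) : Integrable (fun z : ℝ => z ^ n * gaussPDF z) := by
  have h := integrable_rpow_mul_exp_neg_mul_sq (b := 1/2) (by norm_num) (s := (n:ℝ))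
    (by have : (0:ℝ) ≤ n := Nat.cast_nonneg n
        linarith)
  have h2 := h.div_const (Real.sqrt (2 * Real.pi))
  refine h2.congr (Filter.Eventually.of_forall fun z => ?_)
  simp only [gaussPDF, Real.rpow_natCast]
  rw [mul_div_assoc]
  congr 3; ring

theorem gp_sq : ∫ z : ℝ, z ^ 2 * gaussPDF z = 1 := by
  have h := variance_fun_id_gaussianReal (μ := 0) (v := 1)
  rw [variance_eq_integral (by fun_prop)] at h
  rw [integral_gaussianReal_eq_integral_smul one_ne_zero] at h
  simp only [integral_id_gaussianReal, sub_zero, smul_eq_mul, NNReal.coe_one] at h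
  rw [← h]
  congr 1; ext z; rw [gp_eq]; ring

theorem gp_deriv (z : ℝ) : HasDerivAt gaussPDF (-(z * gaussPDF z)) z := by
  have h : HasDerivAt (fun z : ℝ => -z ^ 2 / 2) (-z) z := by
    have := (hasDerivAt_pow 2 z).neg.div_const 2
    exact this.congr_deriv (by norm_num; ring)
  have := h.exp.div_const (Real.sqrt (2 * Real.pi))
  exact this.congr_deriv (by unfold gaussPDF; ring)

theorem gp_top : Filter.Tendsto gaussPDF Filter.atTop (nhds 0) :=
  tendsto_zero_of_hasDerivAt_of_integrableOn_Ioi (a := 0) (fun x _ => gp_deriv x)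
    (by simpa using (gp_int_pow 1).neg.integrableOn) gp_int.integrableOn

theorem gp_bot : Filter.Tendsto gaussPDF Filter.atBot (nhds 0) :=
  tendsto_zero_of_hasDerivAt_of_integrableOn_Iic (a := 0) (fun x _ => gp_deriv x)
    (by simpa using (gp_int_pow 1).neg.integrableOn) gp_int.integrableOn

theorem gp_int_z : Integrable (fun z : ℝ => z * gaussPDF z) := by simpa using gp_int_pow 1

theorem gp_Iic (a : ℝ) : ∫ z in Set.Iic a, z * gaussPDF z = - gaussPDF a := by
  have := integral_Iic_of_hasDerivAt_of_tendsto' (a := a) (f := fun z => - gaussPDF z)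
    (f' := fun z => z * gaussPDF z) (m := -0)
    (fun x _ => (gp_deriv x).neg.congr_deriv (by ring)) gp_int_z.integrableOn gp_bot.neg
  simpa using this

theorem gp_Ioi (a : ℝ) : ∫ z in Set.Ioi a, z * gaussPDF z = gaussPDF a := by
  have := integral_Ioi_of_hasDerivAt_of_tendsto' (a := a) (f := fun z => - gaussPDF z)
    (f' := fun z => z * gaussPDF z) (m := -0)
    (fun x _ => (gp_deriv x).neg.congr_deriv (by ring)) gp_int_z.integrableOn gp_top.neg
  simpa using this

noncomputable def clipf (θ u : ℝ) : ℝ := max (-θ) (min u θ)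

theorem split_int (f : ℝ → ℝ) (hf : Integrable f) (a b : ℝ) (hab : a ≤ b) :
    ∫ z, f z = (∫ z in Set.Iic a, f z) + (∫ z in a..b, f z) + ∫ z in Set.Ioi b, f z := by
  rw [intervalIntegral.integral_of_le hab]
  rw [← setIntegral_union (by
      rw [Set.disjoint_left]; intro x hx hx2; exact absurd hx2.1 (not_lt.2 hx))
    measurableSet_Ioc hf.integrableOn hf.integrableOn, Set.Iic_union_Ioc_eq_Iic hab,
    intervalIntegral.integral_Iic_add_Ioi hf.integrableOn hf.integrableOn]

theorem bdd_int (f : ℝ → ℝ) (hf : Measurable f) (C : ℝ) (hC : ∀ u, |f u| ≤ C)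
    (g : ℝ → ℝ) (hg : Integrable g) : Integrable (fun z => f z * g z) := by
  refine hg.bdd_mul (c := C) hf.aestronglyMeasurable ?_
  exact Filter.Eventually.of_forall fun x => by simpa using hC x

theorem clip_bdd (θ : ℝ) (hθ : 0 ≤ θ) (u : ℝ) : |clipf θ u| ≤ θ := by
  unfold clipf
  rw [abs_le]
  exact ⟨le_max_left _ _, max_le (by linarith) (min_le_right _ _)⟩

theorem clip_meas (θ : ℝ) : Measurable (clipf θ) := by
  unfold clipf; fun_prop

noncomputable def detf (θ u : ℝ) : ℝ := if θ ≤ |u| then 1 else 0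

theorem det_meas (θ : ℝ) : Measurable (detf θ) := by
  unfold detf
  refine Measurable.ite ?_ measurable_const measurable_const
  exact measurableSet_le measurable_const (by fun_prop)

theorem det_bdd (θ u : ℝ) : |detf θ u| ≤ 1 := by
  unfold detf; split_ifs <;> simp

theorem stein (μ θ : ℝ) (hθ : 0 < θ) :
    ∫ z, clipf θ (μ + z) * (z * gaussPDF z) = 1 - ∫ z, detf θ (μ + z) * gaussPDF z := by
  have hab : -θ - μ ≤ θ - μ := by linarith
  have i1 : Integrable (fun z => clipf θ (μ + z) * (z * gaussPDF z)) :=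
    bdd_int (fun z => clipf θ (μ + z)) ((clip_meas θ).comp (by fun_prop)) θ
      (fun u => clip_bdd θ hθ.le _) _ gp_int_z
  have i2 : Integrable (fun z => detf θ (μ + z) * gaussPDF z) :=
    bdd_int (fun z => detf θ (μ + z)) ((det_meas θ).comp (by fun_prop)) 1
      (fun u => det_bdd θ _) _ gp_int
  have e1 : ∫ z in Set.Iic (-θ - μ), clipf θ (μ + z) * (z * gaussPDF z)
      = θ * gaussPDF (-θ - μ) := by
    rw [setIntegral_congr_fun (g := fun z => (-θ) * (z * gaussPDF z)) measurableSet_Iic]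
    · rw [integral_const_mul, gp_Iic]; ring
    · intro z hz
      have hz : z ≤ -θ - μ := hz
      have : clipf θ (μ + z) = -θ := by
        unfold clipf; rw [min_eq_left (by linarith), max_eq_left (by linarith)]
      simp only [this]
  have e3 : ∫ z in Set.Ioi (θ - μ), clipf θ (μ + z) * (z * gaussPDF z)
      = θ * gaussPDF (θ - μ) := by
    rw [setIntegral_congr_fun (g := fun z => θ * (z * gaussPDF z)) measurableSet_Ioi]
    · rw [integral_const_mul, gp_Ioi]
    · intro z hz
      have hz : θ - μ < z := hz
      have : clipf θ (μ + z) = θ := by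
        unfold clipf; rw [min_eq_right (by linarith), max_eq_right (by linarith)]
      simp only [this]
  have e2 : ∫ z in (-θ - μ)..(θ - μ), clipf θ (μ + z) * (z * gaussPDF z)
      = (∫ z in (-θ - μ)..(θ - μ), gaussPDF z) - θ * gaussPDF (θ - μ)
        - θ * gaussPDF (-θ - μ) := by
    rw [intervalIntegral.integral_congr (g := fun z => (μ + z) * (z * gaussPDF z))]
    · have := intervalIntegral.integral_eq_sub_of_hasDerivAt (a := -θ - μ) (b := θ - μ)
        (f := fun z => (μ + z) * gaussPDF z)
        (f' := fun z => gaussPDF z - (μ + z) * (z * gaussPDF z))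
        (fun x _ => by
          have := ((hasDerivAt_id x).const_add μ).mul (gp_deriv x)
          exact this.congr_deriv (by simp only [id]; ring))
        (by
          have := gp_cont
          apply Continuous.intervalIntegrable; fun_prop)
      rw [intervalIntegral.integral_sub (gp_cont.intervalIntegrable _ _)
        (by have := gp_cont
            apply Continuous.intervalIntegrable; fun_prop)] at this
      have h1 : μ + (θ - μ) = θ := by ring
      have h2 : μ + (-θ - μ) = -θ := by ring
      simp only [h1, h2] at this
      linarith
    · intro z hz
      rw [Set.uIcc_of_le hab] at hz
      have : clipf θ (μ + z) = μ + z := by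
        unfold clipf; rw [min_eq_left (by linarith [hz.2]), max_eq_right (by linarith [hz.1])]
      simp only [this]
  have f0 : ∫ z, (1 - detf θ (μ + z)) * gaussPDF z = 1 - ∫ z, detf θ (μ + z) * gaussPDF z := by
    have := integral_sub gp_int i2
    rw [gp_one] at this
    rw [← this]
    congr 1; ext z; ring
  have f1 : ∫ z, (1 - detf θ (μ + z)) * gaussPDF z = ∫ z in (-θ - μ)..(θ - μ), gaussPDF z := by
    rw [intervalIntegral.integral_of_le hab, integral_Ioc_eq_integral_Ioo,
      ← integral_indicator measurableSet_Ioo]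
    congr 1; ext z
    unfold detf
    by_cases h : z ∈ Set.Ioo (-θ - μ) (θ - μ)
    · rw [Set.indicator_of_mem h, if_neg]
      · ring
      · rw [not_le, abs_lt]; constructor <;> linarith [h.1, h.2]
    · rw [Set.indicator_of_notMem h, if_pos]
      · ring
      · by_contra h3
        rw [not_le, abs_lt] at h3
        exact h ⟨by linarith [h3.1], by linarith [h3.2]⟩
  rw [split_int _ i1 _ _ hab, e1, e2, e3, ← f0, f1]; ring

theorem soft_clip (u θ : ℝ) (hθ : 0 < θ) : softThr u θ = u - clipf θ u := by
  unfold softThr clipf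
  rcases lt_trichotomy u 0 with h | h | h
  · rw [Real.sign_of_neg h, abs_of_neg h, min_eq_left (by linarith)]
    rcases le_total (-θ) u with h2 | h2
    · rw [max_eq_right (by linarith), max_eq_right h2]; ring
    · rw [max_eq_left (by linarith), max_eq_left h2]; ring
  · subst h; simp [hθ.le]
  · rw [Real.sign_of_pos h, abs_of_pos h]
    rcases le_total u θ with h2 | h2
    · rw [max_eq_right (by linarith), min_eq_left h2, max_eq_right (by linarith)]; ring
    · rw [max_eq_left (by linarith), min_eq_right h2, max_eq_right (by linarith)]; ring

theorem clip_scale (u θ σ : ℝ) (hσ : 0 < σ) : clipf (σ * θ) (σ * u) = σ * clipf θ u := by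
  unfold clipf
  rw [mul_max_of_nonneg _ _ hσ.le, mul_min_of_nonneg _ _ hσ.le, mul_neg]

theorem clip_sq (θ u : ℝ) (hθ : 0 < θ) : clipf θ u ^ 2 = min (u ^ 2) (θ ^ 2) := by
  unfold clipf
  rcases le_total u θ with h | h
  · rw [min_eq_left h]
    rcases le_total (-θ) u with h2 | h2
    · rw [max_eq_right h2, min_eq_left]; nlinarith
    · rw [max_eq_left h2, min_eq_right]
      · ring
      · nlinarith
  · rw [min_eq_right h, max_eq_right (by linarith), min_eq_right]; nlinarith

noncomputable def AA (f : ℝ → ℝ) (μ : ℝ) : ℝ := ∫ z, f (μ + z) * gaussPDF z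

noncomputable def minf (θ u : ℝ) : ℝ := min (u ^ 2) (θ ^ 2)

theorem min_meas (θ : ℝ) : Measurable (minf θ) := by
  unfold minf; fun_prop

theorem min_bdd (θ u : ℝ) : |minf θ u| ≤ θ ^ 2 := by
  unfold minf
  rw [abs_of_nonneg (le_min (sq_nonneg _) (sq_nonneg _))]
  exact min_le_right _ _

theorem AA_int (f : ℝ → ℝ) (hf : Measurable f) (C : ℝ) (hC : ∀ u, |f u| ≤ C) (μ : ℝ) :
    Integrable (fun z => f (μ + z) * gaussPDF z) :=
  bdd_int (fun z => f (μ + z)) (hf.comp (by fun_prop)) C (fun u => hC _) _ gp_int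

theorem sure (x σ τ : ℝ) (hσ : 0 < σ) (hτ : 0 < τ) :
    ∫ z, (softThr (x + σ * z) τ - x) ^ 2 * gaussPDF z
      = σ ^ 2 * (AA (minf (τ / σ)) (x / σ) - 1 + 2 * AA (detf (τ / σ)) (x / σ)) := by
  have hθ : 0 < τ / σ := by positivity
  have e : ∀ z, (softThr (x + σ * z) τ - x) ^ 2 * gaussPDF z
      = σ ^ 2 * (z ^ 2 * gaussPDF z - 2 * (clipf (τ / σ) (x / σ + z) * (z * gaussPDF z))
          + minf (τ / σ) (x / σ + z) * gaussPDF z) := by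
    intro z
    have h1 : x + σ * z = σ * (x / σ + z) := by field_simp
    have h2 : τ = σ * (τ / σ) := by field_simp
    have h3 : clipf τ (x + σ * z) = σ * clipf (τ / σ) (x / σ + z) := by
      conv_lhs => rw [h1, h2]
      exact clip_scale _ _ _ hσ
    rw [soft_clip _ _ hτ, h3, minf, ← clip_sq _ _ hθ]; ring
  simp_rw [e]
  have i1 : Integrable (fun z => clipf (τ / σ) (x / σ + z) * (z * gaussPDF z)) :=
    bdd_int (fun z => clipf (τ / σ) (x / σ + z)) ((clip_meas _).comp (by fun_prop)) (τ / σ)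
      (fun u => clip_bdd _ hθ.le _) _ gp_int_z
  have i2 := AA_int _ (min_meas (τ / σ)) _ (min_bdd (τ / σ)) (x / σ)
  have i3 : Integrable (fun z => z ^ 2 * gaussPDF z
      - 2 * (clipf (τ / σ) (x / σ + z) * (z * gaussPDF z))) :=
    (gp_int_pow 2).sub (i1.const_mul 2)
  rw [integral_const_mul, integral_add i3 i2,
    integral_sub (gp_int_pow 2) (i1.const_mul 2), gp_sq, integral_const_mul, stein _ _ hθ]
  unfold AA
  ring

theorem det_eq (x σ τ : ℝ) (hσ : 0 < σ) :
    ∫ z in {z : ℝ | τ ≤ |x + σ * z|}, gaussPDF z = AA (detf (τ / σ)) (x / σ) := by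
  rw [← integral_indicator (measurableSet_le measurable_const (by fun_prop))]
  unfold AA
  congr 1; ext z
  have h1 : x + σ * z = σ * (x / σ + z) := by field_simp
  have h4 : τ ≤ |x + σ * z| ↔ τ / σ ≤ |x / σ + z| := by
    rw [h1, abs_mul, abs_of_pos hσ, div_le_iff₀' hσ]
  by_cases h : τ ≤ |x + σ * z|
  · rw [Set.indicator_of_mem (by exact h), detf, if_pos (h4.1 h), one_mul]
  · rw [Set.indicator_of_notMem (by exact h), detf, if_neg (fun h' => h (h4.2 h')), zero_mul]

theorem gp_mono {u v : ℝ} (h : u ^ 2 ≤ v ^ 2) : gaussPDF v ≤ gaussPDF u := by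
  unfold gaussPDF
  gcongr

theorem AA_mono (f : ℝ → ℝ) (hf : Measurable f) (C : ℝ) (hC : ∀ u, |f u| ≤ C)
    (hm : ∀ u v, u ^ 2 ≤ v ^ 2 → f u ≤ f v) (μ₁ μ₂ : ℝ) (h : μ₁ ^ 2 ≤ μ₂ ^ 2) :
    AA f μ₁ ≤ AA f μ₂ := by
  have a1 : ∀ μ, AA f μ = ∫ u, f u * gaussPDF (u - μ) := by
    intro μ
    rw [← integral_add_left_eq_self (fun u => f u * gaussPDF (u - μ)) μ]
    simp [AA]
  have a2 : ∀ μ, AA f μ = ∫ u, f (μ₁ + μ₂ - u) * gaussPDF (μ₁ + μ₂ - u - μ) := by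
    intro μ
    rw [a1, ← integral_sub_left_eq_self (fun u => f u * gaussPDF (u - μ)) volume (μ₁ + μ₂)]
  have ge : ∀ u, gaussPDF (-u) = gaussPDF u := by intro u; simp [gaussPDF]
  have b1 : AA f μ₁ = ∫ u, f (μ₁ + μ₂ - u) * gaussPDF (u - μ₂) := by
    rw [a2]; congr 1; ext u; rw [← ge]; congr 2; ring
  have b2 : AA f μ₂ = ∫ u, f (μ₁ + μ₂ - u) * gaussPDF (u - μ₁) := by
    rw [a2]; congr 1; ext u; rw [← ge]; congr 2; ring
  have i1 : ∀ μ, Integrable (fun u => f u * gaussPDF (u - μ)) := fun μ =>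
    bdd_int f hf C hC _ (gp_int.comp_sub_right μ)
  have i2 : ∀ μ, Integrable (fun u => f (μ₁ + μ₂ - u) * gaussPDF (u - μ)) := fun μ =>
    bdd_int (fun u => f (μ₁ + μ₂ - u)) (hf.comp (by fun_prop)) C (fun _ => hC _) _
      (gp_int.comp_sub_right μ)
  have key : 0 ≤ ∫ u, ((f u * gaussPDF (u - μ₂) - f u * gaussPDF (u - μ₁)) +
      (f (μ₁ + μ₂ - u) * gaussPDF (u - μ₁) - f (μ₁ + μ₂ - u) * gaussPDF (u - μ₂))) := by
    apply integral_nonneg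
    intro u
    have : (0:ℝ) ≤ (f u - f (μ₁ + μ₂ - u)) * (gaussPDF (u - μ₂) - gaussPDF (u - μ₁)) := by
      have hp : 0 ≤ (u ^ 2 - (μ₁ + μ₂ - u) ^ 2) * ((u - μ₁) ^ 2 - (u - μ₂) ^ 2) := by
        have : (u ^ 2 - (μ₁ + μ₂ - u) ^ 2) * ((u - μ₁) ^ 2 - (u - μ₂) ^ 2)
          = (μ₂ ^ 2 - μ₁ ^ 2) * (2 * u - μ₁ - μ₂) ^ 2 := by ring
        rw [this]; exact mul_nonneg (by linarith) (sq_nonneg _)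
      have fe : ∀ {a b : ℝ}, a ^ 2 = b ^ 2 → f a = f b := fun h =>
        le_antisymm (hm _ _ h.le) (hm _ _ h.ge)
      have g_e : ∀ {a b : ℝ}, a ^ 2 = b ^ 2 → gaussPDF a = gaussPDF b := fun h =>
        le_antisymm (gp_mono h.ge) (gp_mono h.le)
      rcases lt_trichotomy (u ^ 2) ((μ₁ + μ₂ - u) ^ 2) with h1 | h1 | h1
      · have h2 : (u - μ₁) ^ 2 - (u - μ₂) ^ 2 ≤ 0 := by
          by_contra h3; push Not at h3; nlinarith
        exact mul_nonneg_of_nonpos_of_nonpos (sub_nonpos.2 (hm _ _ h1.le))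
          (sub_nonpos.2 (gp_mono (by linarith)))
      · rw [fe h1]; simp
      · have h2 : 0 ≤ (u - μ₁) ^ 2 - (u - μ₂) ^ 2 := by
          by_contra h3; push Not at h3; nlinarith
        exact mul_nonneg (sub_nonneg.2 (hm _ _ h1.le))
          (sub_nonneg.2 (gp_mono (by linarith)))
    simp only [Pi.zero_apply]
    linarith
  have i3 : Integrable (fun u => f u * gaussPDF (u - μ₂) - f u * gaussPDF (u - μ₁)) :=
    (i1 _).sub (i1 _)
  have i4 : Integrable (fun u => f (μ₁ + μ₂ - u) * gaussPDF (u - μ₁)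
      - f (μ₁ + μ₂ - u) * gaussPDF (u - μ₂)) := (i2 _).sub (i2 _)
  rw [integral_add i3 i4, integral_sub (i1 _) (i1 _),
    integral_sub (i2 _) (i2 _), ← a1, ← a1, ← b1, ← b2] at key
  linarith

theorem min_mono (θ u v : ℝ) (h : u ^ 2 ≤ v ^ 2) : minf θ u ≤ minf θ v :=
  min_le_min_right _ h

theorem det_mono (θ u v : ℝ) (h : u ^ 2 ≤ v ^ 2) : detf θ u ≤ detf θ v := by
  have := sq_le_sq.1 h
  unfold detf
  split_ifs <;> first | (exfalso; linarith) | norm_num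

theorem AA_bdd (f : ℝ → ℝ) (C : ℝ) (hC : ∀ u, |f u| ≤ C) (μ : ℝ) :
    ‖AA f μ‖ ≤ C := by
  have : ‖AA f μ‖ ≤ ∫ z, C * gaussPDF z := by
    refine norm_integral_le_of_norm_le (gp_int.const_mul C) (Filter.Eventually.of_forall ?_)
    intro z
    rw [norm_mul, Real.norm_eq_abs, Real.norm_eq_abs, abs_of_pos (gp_pos z)]
    exact mul_le_mul_of_nonneg_right (hC _) (gp_pos z).le
  rwa [integral_const_mul, gp_one, mul_one] at this

theorem AA_G (G : Measure ℝ) [IsProbabilityMeasure G] (f : ℝ → ℝ) (hf : Measurable f) (C : ℝ)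
    (hC : ∀ u, |f u| ≤ C) (σ : ℝ) : Integrable (fun x => AA f (x / σ)) G := by
  refine Integrable.of_bound (C := C) ?_ (Filter.Eventually.of_forall fun x => AA_bdd f C hC _)
  have : StronglyMeasurable (fun p : ℝ × ℝ => f (p.1 / σ + p.2) * gaussPDF p.2) := by
    have := gp_cont.measurable
    apply Measurable.stronglyMeasurable
    exact (hf.comp (by fun_prop)).mul (by fun_prop)
  exact (this.integral_prod_right (ν := volume)).aestronglyMeasurable

theorem AA_det_strict (θ₁ θ₂ μ : ℝ) (h0 : 0 < θ₁) (h : θ₁ < θ₂) :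
    AA (detf θ₂) μ < AA (detf θ₁) μ := by
  have i1 := AA_int _ (det_meas θ₁) _ (det_bdd θ₁) μ
  have i2 := AA_int _ (det_meas θ₂) _ (det_bdd θ₂) μ
  have hn : ∀ z, 0 ≤ detf θ₁ (μ + z) * gaussPDF z - detf θ₂ (μ + z) * gaussPDF z := by
    intro z
    rw [← sub_mul]
    refine mul_nonneg ?_ (gp_pos z).le
    unfold detf
    split_ifs <;> first | (exfalso; linarith) | norm_num
  have : 0 < ∫ z, (detf θ₁ (μ + z) * gaussPDF z - detf θ₂ (μ + z) * gaussPDF z) := by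
    rw [integral_pos_iff_support_of_nonneg hn (i1.sub i2)]
    have hs : Set.Ioo (θ₁ - μ) (θ₂ - μ) ⊆ Function.support
        (fun z => detf θ₁ (μ + z) * gaussPDF z - detf θ₂ (μ + z) * gaussPDF z) := by
      intro z hz
      have hp : 0 < μ + z := by linarith [hz.1]
      have h1 : detf θ₁ (μ + z) = 1 := by
        unfold detf; rw [abs_of_pos hp, if_pos]; linarith [hz.1]
      have h2 : detf θ₂ (μ + z) = 0 := by
        unfold detf; rw [abs_of_pos hp, if_neg]; linarith [hz.2]
      simp only [Function.mem_support, h1, h2]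
      simpa using (gp_pos z).ne'
    refine lt_of_lt_of_le ?_ (measure_mono hs)
    rw [Real.volume_Ioo]; simp [h]
  rw [integral_sub i1 i2] at this
  unfold AA; linarith

theorem G_det_strict (G : Measure ℝ) [IsProbabilityMeasure G] (σ θ₁ θ₂ : ℝ) (h0 : 0 < θ₁)
    (h : θ₁ < θ₂) : ∫ x, AA (detf θ₂) (x / σ) ∂G < ∫ x, AA (detf θ₁) (x / σ) ∂G := by
  have i1 := AA_G G _ (det_meas θ₁) _ (det_bdd θ₁) σ
  have i2 := AA_G G _ (det_meas θ₂) _ (det_bdd θ₂) σ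
  have hp : ∀ x : ℝ, 0 < AA (detf θ₁) (x / σ) - AA (detf θ₂) (x / σ) := fun x =>
    sub_pos.2 (AA_det_strict θ₁ θ₂ _ h0 h)
  have : 0 < ∫ x, (AA (detf θ₁) (x / σ) - AA (detf θ₂) (x / σ)) ∂G := by
    rw [integral_pos_iff_support_of_nonneg (fun x => (hp x).le) (i1.sub i2)]
    have : Function.support (fun x => AA (detf θ₁) (x / σ) - AA (detf θ₂) (x / σ)) = Set.univ := by
      ext x; simpa using (hp x).ne'
    rw [this]; simp
  rw [integral_sub i1 i2] at this
  linarith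

theorem sq_div_le (x σ₁ σ₂ : ℝ) (h2 : 0 < σ₂) (h : σ₂ ≤ σ₁) : (x / σ₁) ^ 2 ≤ (x / σ₂) ^ 2 := by
  rw [div_pow, div_pow]
  gcongr

/-- One-sided comparison: the solution with larger `σ` has the smaller ratio, hence equality. -/
theorem amp_aux (G : Measure ℝ) [IsProbabilityMeasure G]
    (δ σw γ : ℝ) (hδ : 0 < δ) (hσw : 0 < σw)
    (σ₁ τ₁ σ₂ τ₂ : ℝ) (hσ₁ : 0 < σ₁) (hτ₁ : 0 < τ₁) (hσ₂ : 0 < σ₂) (hτ₂ : 0 < τ₂)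
    (he1 : σ₁ ^ 2 = σw ^ 2 +
      (1 / δ) * ∫ x, (∫ z, (softThr (x + σ₁ * z) τ₁ - x) ^ 2 * gaussPDF z) ∂G)
    (hd1 : γ = (1 / δ) * ∫ x, (∫ z in {z : ℝ | τ₁ ≤ |x + σ₁ * z|}, gaussPDF z) ∂G)
    (he2 : σ₂ ^ 2 = σw ^ 2 +
      (1 / δ) * ∫ x, (∫ z, (softThr (x + σ₂ * z) τ₂ - x) ^ 2 * gaussPDF z) ∂G)
    (hd2 : γ = (1 / δ) * ∫ x, (∫ z in {z : ℝ | τ₂ ≤ |x + σ₂ * z|}, gaussPDF z) ∂G)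
    (hle : σ₂ ≤ σ₁) :
    σ₁ = σ₂ ∧ τ₁ = τ₂ := by
  have hθ₁ : 0 < τ₁ / σ₁ := by positivity
  have hθ₂ : 0 < τ₂ / σ₂ := by positivity
  simp_rw [sure _ _ _ hσ₁ hτ₁] at he1
  simp_rw [sure _ _ _ hσ₂ hτ₂] at he2
  simp_rw [det_eq _ _ _ hσ₁] at hd1
  simp_rw [det_eq _ _ _ hσ₂] at hd2
  set θ₁ := τ₁ / σ₁ with hθ₁d
  set θ₂ := τ₂ / σ₂ with hθ₂d
  have lin : ∀ θ σ : ℝ, ∫ x, σ ^ 2 * (AA (minf θ) (x / σ) - 1 + 2 * AA (detf θ) (x / σ)) ∂G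
      = σ ^ 2 * ((∫ x, AA (minf θ) (x / σ) ∂G) - 1 + 2 * ∫ x, AA (detf θ) (x / σ) ∂G) := by
    intro θ σ
    have i1 := AA_G G _ (min_meas θ) _ (min_bdd θ) σ
    have i2 := AA_G G _ (det_meas θ) _ (det_bdd θ) σ
    have i3 : Integrable (fun x => AA (minf θ) (x / σ) - 1) G := i1.sub (integrable_const 1)
    rw [integral_const_mul, integral_add i3 (i2.const_mul 2),
      integral_sub i1 (integrable_const 1), integral_const_mul]
    simp
  rw [lin] at he1 he2
  have hdd : ∫ x, AA (detf θ₁) (x / σ₁) ∂G = ∫ x, AA (detf θ₂) (x / σ₂) ∂G := by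
    have : (1 / δ) ≠ 0 := by positivity
    exact mul_left_cancel₀ this (hd1.symm.trans hd2)
  have hm1 : ∫ x, AA (detf θ₁) (x / σ₁) ∂G ≤ ∫ x, AA (detf θ₁) (x / σ₂) ∂G :=
    integral_mono (AA_G G _ (det_meas _) _ (det_bdd _) _) (AA_G G _ (det_meas _) _ (det_bdd _) _)
      fun x => AA_mono _ (det_meas _) _ (det_bdd _) (det_mono _) _ _ (sq_div_le x _ _ hσ₂ hle)
  have hθ : θ₁ ≤ θ₂ := by
    by_contra hc
    push Not at hc
    have := G_det_strict G σ₂ θ₂ θ₁ hθ₂ hc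
    linarith
  have hm2 : ∫ x, AA (minf θ₁) (x / σ₁) ∂G ≤ ∫ x, AA (minf θ₂) (x / σ₂) ∂G := by
    refine integral_mono (AA_G G _ (min_meas _) _ (min_bdd _) _)
      (AA_G G _ (min_meas _) _ (min_bdd _) _) fun x => ?_
    refine (AA_mono _ (min_meas _) _ (min_bdd _) (min_mono _) _ _
      (sq_div_le x _ _ hσ₂ hle)).trans ?_
    refine integral_mono (AA_int _ (min_meas _) _ (min_bdd _) _)
      (AA_int _ (min_meas _) _ (min_bdd _) _) fun z => ?_
    refine mul_le_mul_of_nonneg_right ?_ (gp_pos z).le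
    exact min_le_min_left _ (by gcongr)
  have hσ : σ₁ = σ₂ := by
    refine le_antisymm ?_ hle
    rw [hdd] at he1
    set D := ∫ x, AA (detf θ₂) (x / σ₂) ∂G
    set M₁ := ∫ x, AA (minf θ₁) (x / σ₁) ∂G
    set M₂ := ∫ x, AA (minf θ₂) (x / σ₂) ∂G
    set c₁ := 1 - (1 / δ) * (M₁ - 1 + 2 * D) with hc₁
    set c₂ := 1 - (1 / δ) * (M₂ - 1 + 2 * D) with hc₂
    have hc : c₂ ≤ c₁ := by
      have : (1 / δ) * (M₁ - 1 + 2 * D) ≤ (1 / δ) * (M₂ - 1 + 2 * D) :=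
        mul_le_mul_of_nonneg_left (by linarith) (by positivity)
      linarith
    have q1 : σ₁ ^ 2 * c₁ = σw ^ 2 := by rw [hc₁]; linarith
    have q2 : σ₂ ^ 2 * c₂ = σw ^ 2 := by rw [hc₂]; linarith
    have p2 : 0 < c₂ := by
      by_contra hneg
      push Not at hneg
      have : 0 < σw ^ 2 := by positivity
      nlinarith [sq_nonneg σ₂]
    by_contra hlt
    push Not at hlt
    have : σ₂ ^ 2 < σ₁ ^ 2 := by gcongr
    nlinarith [sq_nonneg σ₁]
  refine ⟨hσ, ?_⟩
  have hθ' : θ₁ = θ₂ := by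
    refine le_antisymm hθ ?_
    by_contra hc
    push Not at hc
    have := G_det_strict G σ₂ θ₁ θ₂ hθ₁ hc
    rw [hσ] at hdd
    linarith
  rw [hθ₁d, hθ₂d, hσ] at hθ'
  field_simp at hθ'
  exact hθ'

/-- the fixed-point equations of AMP with the fixed detection thresholding
policy have at most one solution `(σ, τ)` with `σ, τ > 0`. -/
theorem amp_fixed_detection_unique (G : Measure ℝ) [IsProbabilityMeasure G]
    (hX : Integrable (fun x => x ^ 2) G)
    (δ σw γ : ℝ) (hδ : 0 < δ) (hδ1 : δ ≤ 1) (hσw : 0 < σw) (hγ : 0 < γ) (hγ1 : γ < 1)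
    (σ₁ τ₁ σ₂ τ₂ : ℝ) (hσ₁ : 0 < σ₁) (hτ₁ : 0 < τ₁) (hσ₂ : 0 < σ₂) (hτ₂ : 0 < τ₂)
    (he1 : σ₁ ^ 2 = σw ^ 2 +
      (1 / δ) * ∫ x, (∫ z, (softThr (x + σ₁ * z) τ₁ - x) ^ 2 * gaussPDF z) ∂G)
    (hd1 : γ = (1 / δ) * ∫ x, (∫ z in {z : ℝ | τ₁ ≤ |x + σ₁ * z|}, gaussPDF z) ∂G)
    (he2 : σ₂ ^ 2 = σw ^ 2 +
      (1 / δ) * ∫ x, (∫ z, (softThr (x + σ₂ * z) τ₂ - x) ^ 2 * gaussPDF z) ∂G)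
    (hd2 : γ = (1 / δ) * ∫ x, (∫ z in {z : ℝ | τ₂ ≤ |x + σ₂ * z|}, gaussPDF z) ∂G) :
    σ₁ = σ₂ ∧ τ₁ = τ₂ := by
  rcases le_total σ₂ σ₁ with h | h
  · exact amp_aux G δ σw γ hδ hσw σ₁ τ₁ σ₂ τ₂ hσ₁ hτ₁ hσ₂ hτ₂ he1 hd1 he2 hd2 h
  · have := amp_aux G δ σw γ hδ hσw σ₂ τ₂ σ₁ τ₁ hσ₂ hτ₂ hσ₁ hτ₁ he2 hd2 he1 hd1 h
    exact ⟨this.1.symm, this.2.symm⟩
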